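/- Let (M, φ) be a size pair with φ : M → ℝ^k continuous, let (l, b) be an admissible pair and set F = F_{(l,b)}^φ. A point (x, y) = (s·l + b, t·l + b) ∈ π_{(l,b)} is a discontinuity point of the k-dimensional size function ℓ_{(M,φ)} if and only if (s, t) is a discontinuity point of the 1-dimensional size function ℓ_{(M,F)}. -/

import Mathlib

open scoped ENNReal Manifold
open Filter

noncomputable section

namespace SizeTheory

/-- The 1-dimensional size function of the size pair `(M, φ)`: the number of connected
components of the sublevel set `{φ ≤ t}` containing at least one point of `{φ ≤ s}`. -/
def size1 {M : Type*} [TopologicalSpace M] (φ : M → ℝ) (s t : ℝ) : ℕ :=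
  {S : Set M | ∃ P : M, φ P ≤ s ∧ S = connectedComponentIn {Q : M | φ Q ≤ t} P}.ncard

/-- The k-dimensional size function of the size pair `(M, φ)`: the number of connected
components of `M⟨φ ⪯ y⟩` containing at least one point of `M⟨φ ⪯ x⟩`. -/
def sizek {M : Type*} [TopologicalSpace M] {k : ℕ} (φ : M → Fin k → ℝ)
    (x y : Fin k → ℝ) : ℕ :=
  {S : Set M | ∃ P : M, (∀ i, φ P i ≤ x i) ∧
    S = connectedComponentIn {Q : M | ∀ i, φ Q i ≤ y i} P}.ncard

/-- Multiplicity of a (candidate) proper cornerpoint `(x, y)` of a 1-dimensional size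
function `ℓ`. -/
def mult (ℓ : ℝ → ℝ → ℕ) (x y : ℝ) : ℤ :=
  sInf {v : ℤ | ∃ ε : ℝ, 0 < ε ∧ x + ε < y - ε ∧
    v = (ℓ (x + ε) (y - ε) : ℤ) - (ℓ (x - ε) (y - ε) : ℤ)
      - (ℓ (x + ε) (y + ε) : ℤ) + (ℓ (x - ε) (y + ε) : ℤ)}

/-- Multiplicity of a (candidate) cornerpoint at infinity `(a, ∞)` of a 1-dimensional size
function `ℓ`. -/
def multInf (ℓ : ℝ → ℝ → ℕ) (a : ℝ) : ℤ :=
  sInf {v : ℤ | ∃ ε : ℝ, 0 < ε ∧ a + ε < 1 / ε ∧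
    v = (ℓ (a + ε) (1 / ε) : ℤ) - (ℓ (a - ε) (1 / ε) : ℤ)}

/-- `(x, y)` is a proper cornerpoint of the 1-dimensional size function `ℓ`. -/
def IsProperCornerpoint (ℓ : ℝ → ℝ → ℕ) (x y : ℝ) : Prop :=
  x < y ∧ 0 < mult ℓ x y

/-- `(a, ∞)` is a cornerpoint at infinity (cornerline) of the 1-dimensional size
function `ℓ`. -/
def IsCornerpointAtInfinity (ℓ : ℝ → ℝ → ℕ) (a : ℝ) : Prop :=
  0 < multInf ℓ a

/-- The cost `(y - x)/2` of moving a point of `Δ̄*` (points `(x, y)` with `y` possibly `∞`)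
onto the diagonal. -/
def diagHalf (p : ℝ × WithTop ℝ) : ℝ≥0∞ :=
  WithTop.recTopCoe ⊤ (fun y => ENNReal.ofReal ((y - p.1) / 2)) p.2

/-- `|y - y'|` for ordinates in `ℝ ∪ {∞}`, with the conventions `∞ - y = y - ∞ = ∞`
for `y ≠ ∞` and `∞ - ∞ = 0`. -/
def yDist (y y' : WithTop ℝ) : ℝ≥0∞ :=
  WithTop.recTopCoe (WithTop.recTopCoe 0 (fun _ => (⊤ : ℝ≥0∞)) y')
    (fun a => WithTop.recTopCoe ⊤ (fun b => ENNReal.ofReal |a - b|) y') y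

/-- The pseudometric `δ` used in the definition of the matching distance. -/
def deltaCP (p q : ℝ × WithTop ℝ) : ℝ≥0∞ :=
  min (max (ENNReal.ofReal |p.1 - q.1|) (yDist p.2 q.2)) (max (diagHalf p) (diagHalf q))

/-- The multiplicity, in the augmented multiset of cornerpoints of the 1-dimensional size
function `ℓ`, of a point `p` of `Δ̄*`: cornerpoints (proper or at infinity) are counted
with their multiplicities, and the points of the diagonal with infinite multiplicity. -/
def cpMult (ℓ : ℝ → ℝ → ℕ) (p : ℝ × WithTop ℝ) : ℕ∞ :=
  WithTop.recTopCoe ((multInf ℓ p.1).toNat : ℕ∞)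
    (fun y => if p.1 = y then (⊤ : ℕ∞)
      else if p.1 < y then ((mult ℓ p.1 y).toNat : ℕ∞) else 0) p.2

/-- The underlying "index type" of a multiset of points of `Δ̄*` described by the
multiplicity function `m`: each point `p` appears with multiplicity `m p`. -/
def CPIdx (m : ℝ × WithTop ℝ → ℕ∞) : Type :=
  Σ p : ℝ × WithTop ℝ, {n : ℕ // (n : ℕ∞) < m p}

/-- The matching distance between two 1-dimensional size functions: the infimum, over all
bijections `σ` between the two augmented multisets of cornerpoints, of the supremum of
`δ(P, σ(P))`. -/
def dMatch (ℓ₁ ℓ₂ : ℝ → ℝ → ℕ) : ℝ≥0∞ :=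
  ⨅ σ : CPIdx (cpMult ℓ₁) ≃ CPIdx (cpMult ℓ₂),
    ⨆ a : CPIdx (cpMult ℓ₁), deltaCP a.1 ((σ a).1)

/-- `(l, b)` is an admissible pair: `l` is a unit vector (Euclidean norm) with strictly
positive components, and the components of `b` sum to zero. -/
def Admissible {k : ℕ} (l b : Fin k → ℝ) : Prop :=
  Real.sqrt (∑ i, l i ^ 2) = 1 ∧ (∀ i, 0 < l i) ∧ ∑ i, b i = 0

/-- The 1-dimensional measuring function `F_{(l,b)}^φ (P) = max_i (φ_i(P) - b_i)/l_i`
corresponding to the half-plane `π_{(l,b)}`. -/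
def Fpair {M : Type*} {k : ℕ} (φ : M → Fin k → ℝ) (l b : Fin k → ℝ) (P : M) : ℝ :=
  ⨆ i, (φ P i - b i) / l i

section ManifoldDefs

variable {E : Type*} [NormedAddCommGroup E] [InnerProductSpace ℝ E] [FiniteDimensional ℝ E]
  {H : Type*} [TopologicalSpace H] (I : ModelWithCorners ℝ E H)
  {M : Type*} [TopologicalSpace M] [ChartedSpace H M]

/-- The differential (gradient, up to the Riemannian identification) at `Q` of the `i`-th
component of `φ : M → ℝ^k`, seen as a covector at `Q`. -/
def dcomp {k : ℕ} (φ : M → Fin k → ℝ) (Q : M) (i : Fin k) :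
    TangentSpace I Q →L[ℝ] ℝ :=
  mfderiv I 𝓘(ℝ, ℝ) (fun P => φ P i) Q

/-- `Q` is an `(l, b)`-pseudocritical point for `φ`: the convex hull of the differentials
`dφ_i(Q)`, for the indices `i ∈ I_Q` realizing the maximum defining `F_{(l,b)}^φ (Q)`,
contains the null (co)vector. -/
def LBPseudocritPt {k : ℕ} (l b : Fin k → ℝ) (φ : M → Fin k → ℝ) (Q : M) : Prop :=
  ∃ lam : Fin k → ℝ, (∀ i, 0 ≤ lam i) ∧ (∀ i, lam i ≤ 1) ∧
    (∀ i, lam i ≠ 0 → (φ Q i - b i) / l i = Fpair φ l b Q) ∧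
    (∑ i, lam i) = 1 ∧ (∑ i, lam i • dcomp I φ Q i) = 0

/-- `c` is an `(l, b)`-pseudocritical value for `φ`. -/
def LBPseudocritVal {k : ℕ} (l b : Fin k → ℝ) (φ : M → Fin k → ℝ) (c : ℝ) : Prop :=
  ∃ Q : M, Fpair φ l b Q = c ∧ LBPseudocritPt I l b φ Q

/-- `ξ : M → ℝ^h` is `C¹` at the point `Q`. -/
def C1At {h : ℕ} (ξ : M → Fin h → ℝ) (Q : M) : Prop :=
  ∀ j, ContMDiffAt I 𝓘(ℝ, ℝ) 1 (fun P => ξ P j) Q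

/-- `Q` is a pseudocritical point for `ξ : M → ℝ^h`: `ξ` is `C¹` at `Q` and the convex hull
of the differentials `dξ_1(Q), …, dξ_h(Q)` contains the null (co)vector. -/
def PseudocritPt {h : ℕ} (ξ : M → Fin h → ℝ) (Q : M) : Prop :=
  C1At I ξ Q ∧
  ∃ lam : Fin h → ℝ, (∀ j, 0 ≤ lam j) ∧ (∀ j, lam j ≤ 1) ∧
    (∑ j, lam j) = 1 ∧ (∑ j, lam j • dcomp I ξ Q j) = 0

/-- `v` is a pseudocritical value for `ξ`. -/
def PseudocritVal {h : ℕ} (ξ : M → Fin h → ℝ) (v : Fin h → ℝ) : Prop :=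
  ∃ Q : M, ξ Q = v ∧ PseudocritPt I ξ Q

/-- `v` is a special value for `ξ`: `v` is the image of a point at which `ξ` is not `C¹`. -/
def SpecialVal {h : ℕ} (ξ : M → Fin h → ℝ) (v : Fin h → ℝ) : Prop :=
  ∃ Q : M, ξ Q = v ∧ ¬ C1At I ξ Q

end ManifoldDefs

section Components

variable {M : Type*} [TopologicalSpace M] {A A' B B' : Set M}

/-- The connected components of `B` that contain a point of `A`. -/
def componentsMeeting (A B : Set M) : Set (Set M) :=
  {S | ∃ P ∈ A, S = connectedComponentIn B P}

theorem componentsMeeting_mono_left (h : A ⊆ A') :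
    componentsMeeting A B ⊆ componentsMeeting A' B :=
  fun _ ⟨P, hP, hS⟩ => ⟨P, h hP, hS⟩

theorem componentsMeeting_eq_image (hA : A ⊆ B) (hB : B ⊆ B') :
    componentsMeeting A B' =
      (fun S => ⋃ P ∈ S, connectedComponentIn B' P) '' componentsMeeting A B := by
  have key : ∀ P ∈ A, ⋃ Q ∈ connectedComponentIn B P, connectedComponentIn B' Q =
      connectedComponentIn B' P := by
    intro P hP
    apply Set.Subset.antisymm
    · refine Set.iUnion₂_subset fun Q hQ => ?_
      rw [connectedComponentIn_eq (connectedComponentIn_mono P hB hQ)]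
    · exact Set.subset_biUnion_of_mem (u := fun Q => connectedComponentIn B' Q)
        (mem_connectedComponentIn (hA hP))
  ext S
  constructor
  · rintro ⟨P, hP, rfl⟩
    exact ⟨_, ⟨P, hP, rfl⟩, key P hP⟩
  · rintro ⟨_, ⟨P, hP, rfl⟩, rfl⟩
    exact ⟨P, hP, key P hP⟩

theorem finite_componentsMeeting [LocallyConnectedSpace M] (hA : IsCompact A)
    (hAB : A ⊆ interior B) : (componentsMeeting A B).Finite := by
  obtain ⟨T, hT, hcover⟩ := hA.elim_nhds_subcover (connectedComponentIn (interior B))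
    fun P hP => isOpen_interior.connectedComponentIn.mem_nhds
      (mem_connectedComponentIn (hAB hP))
  refine (T.finite_toSet.image (connectedComponentIn B)).subset ?_
  rintro _ ⟨P, hP, rfl⟩
  obtain ⟨Q, hQ, hPQ⟩ := Set.mem_iUnion₂.1 (hcover hP)
  exact ⟨Q, hQ, connectedComponentIn_eq (connectedComponentIn_mono Q interior_subset hPQ)⟩

theorem ncard_componentsMeeting_le [LocallyConnectedSpace M] (hA : A ⊆ A')
    (hA' : IsCompact A') (hAB : A' ⊆ interior B) (hB : B ⊆ B') :
    (componentsMeeting A B').ncard ≤ (componentsMeeting A' B).ncard := by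
  have hfin := finite_componentsMeeting hA' hAB
  have hsub := componentsMeeting_mono_left (B := B) hA
  rw [componentsMeeting_eq_image (hA.trans (hAB.trans interior_subset)) hB]
  exact (Set.ncard_image_le (hfin.subset hsub)).trans (Set.ncard_le_ncard hsub hfin)

end Components

theorem Fpair_le_iff {M : Type*} {k : ℕ} [Nonempty (Fin k)] {φ : M → Fin k → ℝ}
    {l : Fin k → ℝ} (b : Fin k → ℝ) (hl : ∀ i, 0 < l i) (P : M) (s : ℝ) :
    Fpair φ l b P ≤ s ↔ ∀ i, φ P i ≤ s * l i + b i := by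
  rw [Fpair, ciSup_le_iff (Set.finite_range _).bddAbove]
  refine forall_congr' fun i => ?_
  rw [div_le_iff₀ (hl i), sub_le_iff_le_add]

section SizeFunction

variable {M : Type*} [TopologicalSpace M] {k : ℕ} {φ : M → Fin k → ℝ}

theorem sizek_le_sizek [CompactSpace M] [LocallyConnectedSpace M] (hφ : Continuous φ)
    {x x' y y' : Fin k → ℝ} (hx : x ≤ x') (hxy : ∀ i, x' i < y i) (hy : y ≤ y') :
    sizek φ x y' ≤ sizek φ x' y := by
  have hφi : ∀ i, Continuous fun P => φ P i := fun i => (continuous_apply i).comp hφ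
  have hclosed : IsClosed {P | ∀ i, φ P i ≤ x' i} := by
    simp only [Set.ofPred_forall]
    exact isClosed_iInter fun i => isClosed_le (hφi i) continuous_const
  have hopen : IsOpen {P | ∀ i, φ P i < y i} := by
    simp only [Set.ofPred_forall]
    exact isOpen_iInter_of_finite fun i => isOpen_lt (hφi i) continuous_const
  refine ncard_componentsMeeting_le (A := {P | ∀ i, φ P i ≤ x i})
    (A' := {P | ∀ i, φ P i ≤ x' i}) (B := {P | ∀ i, φ P i ≤ y i})
    (B' := {P | ∀ i, φ P i ≤ y' i}) (fun P hP i => (hP i).trans (hx i)) hclosed.isCompact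
    ?_ (fun P hP i => (hP i).trans (hy i))
  exact fun P hP => interior_maximal (fun Q hQ i => (hQ i).le) hopen
    fun i => (hP i).trans_lt (hxy i)

theorem sizek_eq_size1_Fpair [Nonempty (Fin k)] {l : Fin k → ℝ} (b : Fin k → ℝ)
    (hl : ∀ i, 0 < l i) (s t : ℝ) :
    sizek φ (fun i => s * l i + b i) (fun i => t * l i + b i) = size1 (Fpair φ l b) s t := by
  simp only [sizek, size1, Fpair_le_iff b hl]

theorem Admissible.nonempty {l b : Fin k → ℝ} (h : Admissible l b) : Nonempty (Fin k) := by
  by_contra hk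
  rw [not_nonempty_iff] at hk
  simpa using h.1

theorem eventually_mem_Icc_scaled {l : Fin k → ℝ} (b : Fin k → ℝ) (hl : ∀ i, 0 < l i)
    (s : ℝ) {ε : ℝ} (hε : 0 < ε) :
    ∀ᶠ x in nhds fun i => s * l i + b i,
      x ∈ Set.Icc (fun i => (s - ε) * l i + b i) (fun i => (s + ε) * l i + b i) := by
  refine pi_Icc_mem_nhds (fun i => ?_) (fun i => ?_) <;> nlinarith [mul_pos hε (hl i)]

end SizeFunction

/-- A point `(x, y) = (s·l + b, t·l + b)` of the half-plane `π_{(l,b)}` is a discontinuity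
point of `ℓ_{(M,φ)}` if and only if `(s, t)` is a discontinuity point of `ℓ_{(M,F)}`,
where `F = F_{(l,b)}^φ`. -/
theorem discontinuity_halfplane {k : ℕ} {M : Type*} [TopologicalSpace M] [Nonempty M]
    [CompactSpace M] [LocallyConnectedSpace M] [T2Space M]
    (φ : M → Fin k → ℝ) (hφ : Continuous φ)
    (l b : Fin k → ℝ) (hadm : Admissible l b) (s t : ℝ) (hst : s < t) :
    (¬ ContinuousAt (fun p : (Fin k → ℝ) × (Fin k → ℝ) => (sizek φ p.1 p.2 : ℝ))
        (fun i => s * l i + b i, fun i => t * l i + b i)) ↔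
    (¬ ContinuousAt (fun p : ℝ × ℝ => (size1 (Fpair φ l b) p.1 p.2 : ℝ)) (s, t)) := by
  have := hadm.nonempty
  have hl := hadm.2.1
  rw [not_iff_not]
  constructor
  · intro h
    have hcont : Continuous fun p : ℝ × ℝ =>
        ((fun i => p.1 * l i + b i, fun i => p.2 * l i + b i) :
          (Fin k → ℝ) × (Fin k → ℝ)) := by fun_prop
    refine (ContinuousAt.comp (x := (s, t)) h hcont.continuousAt).congr (.of_forall fun p => ?_)
    simp only [Function.comp_apply, sizek_eq_size1_Fpair b hl]
  · intro h
    rw [ContinuousAt, Metric.tendsto_nhds] at h ⊢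
    intro e he
    obtain ⟨δ, hδ, hball⟩ := Metric.eventually_nhds_iff.1 (h e he)
    obtain ⟨ε, hε, hεmin⟩ := exists_between (lt_min hδ (half_pos (sub_pos.2 hst)))
    obtain ⟨hεδ, hεst⟩ := lt_min_iff.1 hεmin
    have hlow := hball (y := (s - ε, t + ε)) (by
      simp [Prod.dist_eq, abs_of_pos hε, hεδ])
    have hupp := hball (y := (s + ε, t - ε)) (by
      simp [Prod.dist_eq, abs_of_pos hε, hεδ])
    rw [nhds_prod_eq]
    filter_upwards [(eventually_mem_Icc_scaled b hl s hε).prod_mk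
      (eventually_mem_Icc_scaled b hl t hε)] with p ⟨hx, hy⟩
    have hgap : ∀ i, (s + ε) * l i + b i < (t - ε) * l i + b i := fun i => by
      nlinarith [hl i]
    have h₁ := sizek_le_sizek hφ hx.1
      (fun i => (hx.2 i).trans_lt ((hgap i).trans_le (hy.1 i))) hy.2
    have h₂ := sizek_le_sizek hφ hx.2 hgap hy.1
    rw [sizek_eq_size1_Fpair b hl] at h₁ h₂
    rw [← Nat.cast_le (α := ℝ)] at h₁ h₂
    simp only [Real.dist_eq, abs_lt, sizek_eq_size1_Fpair b hl] at hlow hupp ⊢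
    constructor <;> linarith [hlow.1, hupp.2]

end SizeTheory
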